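/- For all vectors u, v, w, X, ξ in V, the trace of the composite endomorphism c̃(u)∘c̃(v)∘c̃(w)∘c(X)∘ε(ξ)∘ι(ξ) of ΛV equals (a₀b₀(a₀+b₀)/4)·|ξ|²·[g(u,X)g(v,w) − g(v,X)g(u,w) + g(w,X)g(u,v)]·Tr(Id) + (a₀b₀(a₀−b₀)/4)·ξ(X)·[ξ(u)g(v,w) − ξ(v)g(u,w) + ξ(w)g(u,v)]·Tr(Id). -/

import Mathlib

open scoped RealInnerProductSpace

noncomputable def eps {V : Type*} [NormedAddCommGroup V] [InnerProductSpace ℝ V]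
    (v : V) : Module.End ℝ (ExteriorAlgebra ℝ V) :=
  LinearMap.mulLeft ℝ (ExteriorAlgebra.ι ℝ v)

noncomputable def iot {V : Type*} [NormedAddCommGroup V] [InnerProductSpace ℝ V]
    (v : V) : Module.End ℝ (ExteriorAlgebra ℝ V) :=
  CliffordAlgebra.contractLeft (innerₛₗ ℝ v)

noncomputable def ctil {V : Type*} [NormedAddCommGroup V] [InnerProductSpace ℝ V]
    (a₀ b₀ : ℝ) (v : V) : Module.End ℝ (ExteriorAlgebra ℝ V) :=
  a₀ • eps v - b₀ • iot v

noncomputable def cbar {V : Type*} [NormedAddCommGroup V] [InnerProductSpace ℝ V]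
    (a₀ b₀ : ℝ) (v : V) : Module.End ℝ (ExteriorAlgebra ℝ V) :=
  b₀ • eps v - a₀ • iot v

noncomputable def cmap {V : Type*} [NormedAddCommGroup V] [InnerProductSpace ℝ V]
    (v : V) : Module.End ℝ (ExteriorAlgebra ℝ V) :=
  eps v - iot v

noncomputable def chat {V : Type*} [NormedAddCommGroup V] [InnerProductSpace ℝ V]
    (v : V) : Module.End ℝ (ExteriorAlgebra ℝ V) :=
  eps v + iot v

/-- Wick's formula for a tracial functional and two elements with scalar anticommutator. -/
theorem tracial_mul_two {A : Type*} [Ring A] [Algebra ℝ A] (τ : A →ₗ[ℝ] ℝ)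
    (hτ : ∀ a b, τ (a * b) = τ (b * a)) (x₁ x₂ : A) (s : ℝ)
    (h : x₁ * x₂ + x₂ * x₁ = s • 1) : τ (x₁ * x₂) = s / 2 * τ 1 := by
  have key := congrArg τ h
  rw [map_add, map_smul, smul_eq_mul, hτ x₂ x₁] at key
  linarith

/-- Wick's formula for four elements: one contraction step. -/
theorem tracial_mul_four {A : Type*} [Ring A] [Algebra ℝ A] (τ : A →ₗ[ℝ] ℝ)
    (hτ : ∀ a b, τ (a * b) = τ (b * a)) (x₁ x₂ x₃ x₄ : A) (s₂ s₃ s₄ : ℝ)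
    (h₂ : x₁ * x₂ + x₂ * x₁ = s₂ • 1) (h₃ : x₁ * x₃ + x₃ * x₁ = s₃ • 1)
    (h₄ : x₁ * x₄ + x₄ * x₁ = s₄ • 1) :
    τ (x₁ * x₂ * x₃ * x₄) =
      s₂ / 2 * τ (x₃ * x₄) - s₃ / 2 * τ (x₂ * x₄) + s₄ / 2 * τ (x₂ * x₃) := by
  have key : x₁ * x₂ * x₃ * x₄ + x₂ * x₃ * x₄ * x₁ =
      s₂ • (x₃ * x₄) - s₃ • (x₂ * x₄) + s₄ • (x₂ * x₃) := by
    calc _ = (x₁ * x₂ + x₂ * x₁) * (x₃ * x₄) - x₂ * (x₁ * x₃ + x₃ * x₁) * x₄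
          + x₂ * x₃ * (x₁ * x₄ + x₄ * x₁) := by noncomm_ring
      _ = _ := by rw [h₂, h₃, h₄]; simp
  have key' := congrArg τ key
  have cyc : τ (x₂ * x₃ * x₄ * x₁) = τ (x₁ * x₂ * x₃ * x₄) := by
    rw [hτ]; simp only [mul_assoc]
  simp only [map_add, map_sub, map_smul, smul_eq_mul, cyc] at key'
  linarith

/-- Wick's formula for six elements: one contraction step. -/
theorem tracial_mul_six {A : Type*} [Ring A] [Algebra ℝ A] (τ : A →ₗ[ℝ] ℝ)
    (hτ : ∀ a b, τ (a * b) = τ (b * a)) (x₁ x₂ x₃ x₄ x₅ x₆ : A) (s₂ s₃ s₄ s₅ s₆ : ℝ)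
    (h₂ : x₁ * x₂ + x₂ * x₁ = s₂ • 1) (h₃ : x₁ * x₃ + x₃ * x₁ = s₃ • 1)
    (h₄ : x₁ * x₄ + x₄ * x₁ = s₄ • 1) (h₅ : x₁ * x₅ + x₅ * x₁ = s₅ • 1)
    (h₆ : x₁ * x₆ + x₆ * x₁ = s₆ • 1) :
    τ (x₁ * x₂ * x₃ * x₄ * x₅ * x₆) =
      s₂ / 2 * τ (x₃ * x₄ * x₅ * x₆) - s₃ / 2 * τ (x₂ * x₄ * x₅ * x₆)
        + s₄ / 2 * τ (x₂ * x₃ * x₅ * x₆) - s₅ / 2 * τ (x₂ * x₃ * x₄ * x₆)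
        + s₆ / 2 * τ (x₂ * x₃ * x₄ * x₅) := by
  have key : x₁ * x₂ * x₃ * x₄ * x₅ * x₆ + x₂ * x₃ * x₄ * x₅ * x₆ * x₁ =
      s₂ • (x₃ * x₄ * x₅ * x₆) - s₃ • (x₂ * x₄ * x₅ * x₆) + s₄ • (x₂ * x₃ * x₅ * x₆)
        - s₅ • (x₂ * x₃ * x₄ * x₆) + s₆ • (x₂ * x₃ * x₄ * x₅) := by
    calc _ = (x₁ * x₂ + x₂ * x₁) * (x₃ * x₄ * x₅ * x₆)
          - x₂ * (x₁ * x₃ + x₃ * x₁) * (x₄ * x₅ * x₆)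
          + x₂ * x₃ * (x₁ * x₄ + x₄ * x₁) * (x₅ * x₆)
          - x₂ * x₃ * x₄ * (x₁ * x₅ + x₅ * x₁) * x₆
          + x₂ * x₃ * x₄ * x₅ * (x₁ * x₆ + x₆ * x₁) := by noncomm_ring
      _ = _ := by rw [h₂, h₃, h₄, h₅, h₆]; simp [mul_assoc]
  have key' := congrArg τ key
  have cyc : τ (x₂ * x₃ * x₄ * x₅ * x₆ * x₁) = τ (x₁ * x₂ * x₃ * x₄ * x₅ * x₆) := by
    rw [hτ]; simp only [mul_assoc]
  simp only [map_add, map_sub, map_smul, smul_eq_mul, cyc] at key'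
  linarith

theorem eps_anticomm {V : Type*} [NormedAddCommGroup V] [InnerProductSpace ℝ V] (v w : V) :
    eps v * eps w + eps w * eps v = 0 := by
  refine LinearMap.ext fun x => ?_
  simp [eps, ← mul_assoc, ← add_mul]

theorem iot_anticomm {V : Type*} [NormedAddCommGroup V] [InnerProductSpace ℝ V] (v w : V) :
    iot v * iot w + iot w * iot v = 0 := by
  refine LinearMap.ext fun x => ?_
  simp only [iot, LinearMap.add_apply, Module.End.mul_apply, LinearMap.zero_apply]
  rw [CliffordAlgebra.contractLeft_comm, neg_add_cancel]

theorem eps_iot_anticomm {V : Type*} [NormedAddCommGroup V] [InnerProductSpace ℝ V] (v w : V) :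
    eps v * iot w + iot w * eps v = ⟪v, w⟫ • (1 : Module.End ℝ (ExteriorAlgebra ℝ V)) := by
  refine LinearMap.ext fun x => ?_
  have h := CliffordAlgebra.contractLeft_ι_mul (Q := (0 : QuadraticForm ℝ V)) (innerₛₗ ℝ w) v x
  simp only [iot, eps, LinearMap.add_apply, Module.End.mul_apply, LinearMap.mulLeft_apply,
    LinearMap.smul_apply, Module.End.one_apply]
  erw [h]
  rw [innerₛₗ_apply_apply, real_inner_comm]
  exact add_sub_cancel _ _

/-- Real combinations of exterior and interior multiplications have scalar anticommutators. -/
theorem eps_iot_comb_anticomm {V : Type*} [NormedAddCommGroup V] [InnerProductSpace ℝ V]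
    (a b c d : ℝ) (v w : V) :
    (a • eps v + b • iot v) * (c • eps w + d • iot w)
        + (c • eps w + d • iot w) * (a • eps v + b • iot v) =
      ((a * d + b * c) * ⟪v, w⟫) • (1 : Module.End ℝ (ExteriorAlgebra ℝ V)) := by
  have h₃ := eps_iot_anticomm w v
  rw [real_inner_comm] at h₃
  calc _ = (a * c) • (eps v * eps w + eps w * eps v) + (b * d) • (iot v * iot w + iot w * iot v)
        + (a * d) • (eps v * iot w + iot w * eps v)
        + (b * c) • (eps w * iot v + iot v * eps w) := by
          simp only [mul_add, add_mul, smul_mul_smul_comm, smul_add, mul_comm c, mul_comm d]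
          abel
    _ = _ := by
          rw [eps_anticomm, iot_anticomm, eps_iot_anticomm, h₃]
          module

theorem statement_3 {V : Type*} [NormedAddCommGroup V] [InnerProductSpace ℝ V]
    [FiniteDimensional ℝ V] (a₀ b₀ : ℝ) (u v w X ξ : V) :
    LinearMap.trace ℝ (ExteriorAlgebra ℝ V) (ctil a₀ b₀ u * ctil a₀ b₀ v * ctil a₀ b₀ w * cmap X * eps ξ * iot ξ) =
      a₀ * b₀ * (a₀ + b₀) / 4 * ⟪ξ, ξ⟫ * (⟪u, X⟫ * ⟪v, w⟫ - ⟪v, X⟫ * ⟪u, w⟫ + ⟪w, X⟫ * ⟪u, v⟫) * LinearMap.trace ℝ (ExteriorAlgebra ℝ V) 1 +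
        a₀ * b₀ * (a₀ - b₀) / 4 * ⟪ξ, X⟫ * (⟪ξ, u⟫ * ⟪v, w⟫ - ⟪ξ, v⟫ * ⟪u, w⟫ + ⟪ξ, w⟫ * ⟪u, v⟫) * LinearMap.trace ℝ (ExteriorAlgebra ℝ V) 1 := by
  have hτ : ∀ f g : Module.End ℝ (ExteriorAlgebra ℝ V),
      LinearMap.trace ℝ _ (f * g) = LinearMap.trace ℝ _ (g * f) := LinearMap.trace_mul_comm ℝ
  have ht (z : V) : ctil a₀ b₀ z = a₀ • eps z + (-b₀) • iot z := by
    rw [ctil]; module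
  have hc : cmap X = (1 : ℝ) • eps X + (-1 : ℝ) • iot X := by
    rw [cmap]; module
  have he : eps ξ = (1 : ℝ) • eps ξ + (0 : ℝ) • iot ξ := by simp
  have hi : iot ξ = (0 : ℝ) • eps ξ + (1 : ℝ) • iot ξ := by simp
  have htt (y z : V) := eps_iot_comb_anticomm a₀ (-b₀) a₀ (-b₀) y z
  have htc (y : V) := eps_iot_comb_anticomm a₀ (-b₀) 1 (-1) y X
  have hte (y : V) := eps_iot_comb_anticomm a₀ (-b₀) 1 0 y ξ
  have hti (y : V) := eps_iot_comb_anticomm a₀ (-b₀) 0 1 y ξ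
  have hce := eps_iot_comb_anticomm 1 (-1) 1 0 X ξ
  have hci := eps_iot_comb_anticomm 1 (-1) 0 1 X ξ
  have hei := eps_iot_comb_anticomm 1 0 0 1 ξ ξ
  simp only [← ht, ← hc, ← he, ← hi] at htt htc hte hti hce hci hei
  rw [tracial_mul_six _ hτ _ _ _ _ _ _ _ _ _ _ _ (htt u v) (htt u w) (htc u) (hte u) (hti u),
    tracial_mul_four _ hτ _ _ _ _ _ _ _ (htc w) (hte w) (hti w),
    tracial_mul_four _ hτ _ _ _ _ _ _ _ (htc v) (hte v) (hti v),
    tracial_mul_four _ hτ _ _ _ _ _ _ _ (htt v w) (hte v) (hti v),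
    tracial_mul_four _ hτ _ _ _ _ _ _ _ (htt v w) (htc v) (hti v),
    tracial_mul_four _ hτ _ _ _ _ _ _ _ (htt v w) (htc v) (hte v),
    tracial_mul_two _ hτ _ _ _ hei, tracial_mul_two _ hτ _ _ _ hce,
    tracial_mul_two _ hτ _ _ _ hci, tracial_mul_two _ hτ _ _ _ (htc w),
    tracial_mul_two _ hτ _ _ _ (hte w), tracial_mul_two _ hτ _ _ _ (hti w)]
  rw [real_inner_comm ξ X, real_inner_comm ξ u, real_inner_comm ξ v, real_inner_comm ξ w]
  ring
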